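/- arXiv:2305.08128 — 2 statements merged into one kernel-verified Lean document; each statement's English description precedes it below -/
import Mathlib

section
/- Fix γ > 0 and β < 0, and let m(k) = k·coth(k) = k·cosh(k)/sinh(k) for k > 0. Then there exists a unique k_c > 0 satisfying k_c³·(−4k_c·csch²(k_c) + 2k_c²·coth(k_c)·csch²(k_c) + 2coth(k_c)) = 2γ/|β|, where csch(k) = 1/sinh(k); moreover, the modulational instability index Δ(k) = (c_p(k) − c_p(2k))·c_g'(k) of the Ostrovsky–ILW equation satisfies Δ(k) > 0 for 0 < k < k_c and Δ(k) < 0 for k > k_c. -/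
open Real Set Filter Topology

theorem sq_div_two_le_cosh_sub_one (k : ℝ) : k ^ 2 / 2 ≤ cosh k - 1 := by
  have h : cosh k = 1 + 2 * sinh (k / 2) ^ 2 := by
    have h2 := cosh_two_mul (k / 2)
    rw [mul_div_cancel₀ k two_ne_zero, cosh_sq] at h2
    linarith
  have h3 : |k / 2| ≤ |sinh (k / 2)| := by
    rw [abs_sinh]
    exact self_le_sinh_iff.2 (abs_nonneg _)
  have h4 := sq_le_sq.2 h3
  nlinarith

/-- The function `k³ (2 m'(k) + k m''(k))` for `m(k) = k coth k`, over a common denominator. -/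
noncomputable def ilwCurvature (k : ℝ) : ℝ :=
  2 * k ^ 3 * (cosh k * sinh k ^ 2 - 2 * k * sinh k + k ^ 2 * cosh k) / sinh k ^ 3

theorem hasDerivAt_ilwCurvature {k : ℝ} (hk : 0 < k) :
    HasDerivAt ilwCurvature
      (2 * k ^ 2 * (3 * cosh k * sinh k ^ 3 - 9 * k * sinh k ^ 2 + 9 * k ^ 2 * cosh k * sinh k
        - 2 * k ^ 3 * sinh k ^ 2 - 3 * k ^ 3) / sinh k ^ 4) k := by
  have hS : sinh k ≠ 0 := (sinh_pos_iff.2 hk).ne'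
  have hs := hasDerivAt_sinh k
  have hc := hasDerivAt_cosh k
  have hi := hasDerivAt_id' k
  have hN := ((hc.mul (hs.pow 2)).sub ((hi.const_mul 2).mul hs)).add ((hi.pow 2).mul hc)
  refine ((((hi.pow 3).const_mul 2).mul hN).div (hs.pow 3) (pow_ne_zero 3 hS)).congr_deriv ?_
  have hC : cosh k ^ 2 = sinh k ^ 2 + 1 := cosh_sq k
  simp only [Pi.mul_apply, Pi.pow_apply, Pi.add_apply, Pi.sub_apply]
  field_simp
  push_cast
  generalize cosh k = C at *
  generalize sinh k = S at *
  ring_nf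
  simp only [hC]
  ring

theorem strictMonoOn_ilwCurvature : StrictMonoOn ilwCurvature (Ioi 0) := by
  refine strictMonoOn_of_deriv_pos (convex_Ioi 0)
    (fun k hk => (hasDerivAt_ilwCurvature hk).continuousAt.continuousWithinAt) fun k hk => ?_
  rw [interior_Ioi] at hk
  have hk : 0 < k := hk
  rw [(hasDerivAt_ilwCurvature hk).deriv]
  have hS : 0 < sinh k := sinh_pos_iff.2 hk
  have hSk : k ≤ sinh k := self_le_sinh_iff.2 hk.le
  have hC := sq_div_two_le_cosh_sub_one k
  have h1 : 0 ≤ (sinh k - k) ^ 3 := pow_nonneg (sub_nonneg.2 hSk) 3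
  have h2 : k ^ 2 / 2 * (sinh k ^ 3 + 3 * k ^ 2 * sinh k) ≤
      (cosh k - 1) * (sinh k ^ 3 + 3 * k ^ 2 * sinh k) :=
    mul_le_mul_of_nonneg_right hC (by positivity)
  have h3 : 0 < k ^ 2 * sinh k * (sinh k ^ 2 / 2 + (sinh k - k) ^ 2 + 7 / 2 * k ^ 2) := by
    positivity
  have h4 : 0 < 3 * cosh k * sinh k ^ 3 - 9 * k * sinh k ^ 2 + 9 * k ^ 2 * cosh k * sinh k
      - 2 * k ^ 3 * sinh k ^ 2 - 3 * k ^ 3 := by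
    linarith
  positivity

theorem ilwCurvature_le {k : ℝ} (hk : 0 < k) : ilwCurvature k ≤ 4 * k ^ 2 * cosh k := by
  have hS : 0 < sinh k := sinh_pos_iff.2 hk
  have hSk : k ≤ sinh k := self_le_sinh_iff.2 hk.le
  have hC : 0 < cosh k := cosh_pos k
  rw [ilwCurvature, div_le_iff₀ (by positivity)]
  have h1 : cosh k * sinh k ^ 2 - 2 * k * sinh k + k ^ 2 * cosh k ≤
      2 * cosh k * sinh k ^ 2 := by
    have : k ^ 2 * cosh k ≤ sinh k ^ 2 * cosh k := by gcongr
    have : 0 < 2 * k * sinh k := by positivity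
    linarith
  calc _ ≤ 2 * k ^ 3 * (2 * cosh k * sinh k ^ 2) := by gcongr
    _ = 4 * k ^ 2 * cosh k * (k * sinh k ^ 2) := by ring
    _ ≤ 4 * k ^ 2 * cosh k * (sinh k * sinh k ^ 2) := by gcongr
    _ = _ := by ring

theorem le_ilwCurvature {k : ℝ} (hk : 2 ≤ k) : 2 * k ^ 3 ≤ ilwCurvature k := by
  have hS : 0 < sinh k := sinh_pos_iff.2 (by linarith)
  have hC : sinh k ≤ cosh k := (sinh_lt_cosh k).le
  rw [ilwCurvature, le_div_iff₀ (by positivity)]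
  have h1 : sinh k * (sinh k ^ 2 + k ^ 2) ≤ cosh k * (sinh k ^ 2 + k ^ 2) := by gcongr
  have h2 : 0 ≤ k * (k - 2) * sinh k :=
    mul_nonneg (mul_nonneg (by linarith) (by linarith)) hS.le
  gcongr
  linarith

theorem exists_ilwCurvature_eq {T : ℝ} (hT : 0 < T) : ∃ k, 0 < k ∧ ilwCurvature k = T := by
  have h0 : Tendsto (fun k : ℝ => 4 * k ^ 2 * cosh k) (𝓝[>] 0) (𝓝 0) := by
    have h : Continuous fun k : ℝ => 4 * k ^ 2 * cosh k := by fun_prop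
    simpa using (h.tendsto 0).mono_left nhdsWithin_le_nhds
  obtain ⟨a, haT, ha⟩ := ((h0.eventually_lt_const hT).and self_mem_nhdsWithin).exists
  have ha : 0 < a := ha
  have hb : 0 < T + 2 := by linarith
  have hbT : T ≤ ilwCurvature (T + 2) := by
    refine le_trans ?_ (le_ilwCurvature (by linarith))
    nlinarith [pow_pos hT 3, pow_pos hT 2]
  obtain ⟨k, hk, hkT⟩ := isPreconnected_Ioi.intermediate_value (mem_Ioi.2 ha) (mem_Ioi.2 hb)
    (fun k hk => (hasDerivAt_ilwCurvature hk).continuousAt.continuousWithinAt)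
    ⟨((ilwCurvature_le ha).trans_lt haT).le, hbT⟩
  exact ⟨k, hk, hkT⟩

theorem ilwCurvature_eq {k : ℝ} (hk : 0 < k) :
    k ^ 3 * (-4 * k * (1 / sinh k) ^ 2 + 2 * k ^ 2 * (cosh k / sinh k) * (1 / sinh k) ^ 2 +
      2 * (cosh k / sinh k)) = ilwCurvature k := by
  have hS : sinh k ≠ 0 := (sinh_pos_iff.2 hk).ne'
  rw [ilwCurvature]
  field_simp
  ring

theorem hasDerivAt_mul_cosh_div_sinh {k : ℝ} (hk : 0 < k) :
    HasDerivAt (fun k => k * cosh k / sinh k) (cosh k / sinh k - k / sinh k ^ 2) k := by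
  have hS : sinh k ≠ 0 := (sinh_pos_iff.2 hk).ne'
  refine (((hasDerivAt_id' k).mul (hasDerivAt_cosh k)).div (hasDerivAt_sinh k) hS).congr_deriv ?_
  have hC : cosh k ^ 2 = sinh k ^ 2 + 1 := cosh_sq k
  simp only [Pi.mul_apply]
  field_simp
  linear_combination -k * hC

theorem deriv_ilw_groupVelocity (γ β : ℝ) {k : ℝ} (hk : 0 < k) :
    deriv (fun k => β * (k * cosh k / sinh k +
      k * deriv (fun k => k * cosh k / sinh k) k) - γ / k ^ 2) k =
      (β * ilwCurvature k + 2 * γ) / k ^ 3 := by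
  have hS : sinh k ≠ 0 := (sinh_pos_iff.2 hk).ne'
  have he : (fun k => β * (k * cosh k / sinh k +
      k * deriv (fun k => k * cosh k / sinh k) k) - γ / k ^ 2) =ᶠ[𝓝 k]
      fun k => β * (2 * (k * cosh k / sinh k) - k ^ 2 / sinh k ^ 2) - γ / k ^ 2 := by
    filter_upwards [Ioi_mem_nhds hk] with x hx
    rw [(hasDerivAt_mul_cosh_div_sinh hx).deriv]
    ring
  rw [he.deriv_eq]
  have hi := (hasDerivAt_id' k).pow 2
  have hd := ((((hasDerivAt_mul_cosh_div_sinh hk).const_mul 2).sub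
    (hi.div ((hasDerivAt_sinh k).pow 2) (pow_ne_zero 2 hS))).const_mul β).sub
    ((hasDerivAt_const k γ).div hi (pow_ne_zero 2 hk.ne'))
  refine (hd.congr_deriv ?_).deriv
  rw [ilwCurvature]
  simp only [Pi.pow_apply]
  field_simp
  push_cast
  ring

theorem mul_cosh_div_sinh_lt_two_mul {k : ℝ} (hk : 0 < k) :
    k * cosh k / sinh k < 2 * k * cosh (2 * k) / sinh (2 * k) := by
  have hS : 0 < sinh k := sinh_pos_iff.2 hk
  have hC : 0 < cosh k := cosh_pos k
  rw [cosh_two_mul, sinh_two_mul, div_lt_div_iff₀ hS (by positivity)]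
  have : 0 < 2 * k * sinh k ^ 3 := by positivity
  linarith

theorem ilw_phaseVelocity_sub_pos {γ β k : ℝ} (hγ : 0 < γ) (hβ : β < 0) (hk : 0 < k) :
    0 < (β * (k * cosh k / sinh k) + γ / k ^ 2) -
      (β * (2 * k * cosh (2 * k) / sinh (2 * k)) + γ / (2 * k) ^ 2) := by
  have h1 := mul_lt_mul_of_neg_left (mul_cosh_div_sinh_lt_two_mul hk) hβ
  have h2 : γ / (2 * k) ^ 2 < γ / k ^ 2 := by
    gcongr
    linarith
  linarith


/-- For the Ostrovsky–ILW equation (symbol `m(k) = k·coth(k)`) with `γ > 0`, `β < 0`: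
there is a unique `k_c > 0` with
`k_c³·(−4k_c·csch²(k_c) + 2k_c²·coth(k_c)·csch²(k_c) + 2coth(k_c)) = 2γ/|β|`,
and the modulational instability index `Δ(k) = (c_p(k) − c_p(2k))·c_g'(k)` satisfies
`Δ(k) > 0` for `0 < k < k_c` and `Δ(k) < 0` for `k > k_c`. -/
theorem stmt_8 (γ β : ℝ) (hγ : 0 < γ) (hβ : β < 0) :
    let m : ℝ → ℝ := fun k => k * Real.cosh k / Real.sinh k
    let cp : ℝ → ℝ := fun k => β * m k + γ / k ^ 2
    let cg : ℝ → ℝ := fun k => β * (m k + k * deriv m k) - γ / k ^ 2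
    let Δ : ℝ → ℝ := fun k => (cp k - cp (2 * k)) * deriv cg k
    let coth : ℝ → ℝ := fun k => Real.cosh k / Real.sinh k
    let csch : ℝ → ℝ := fun k => 1 / Real.sinh k
    ∃ kc : ℝ, 0 < kc ∧
      kc ^ 3 * (-4 * kc * csch kc ^ 2 + 2 * kc ^ 2 * coth kc * csch kc ^ 2 +
        2 * coth kc) = 2 * γ / |β| ∧
      (∀ k : ℝ, 0 < k →
        k ^ 3 * (-4 * k * csch k ^ 2 + 2 * k ^ 2 * coth k * csch k ^ 2 +
          2 * coth k) = 2 * γ / |β| → k = kc) ∧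
      (∀ k : ℝ, 0 < k → k < kc → 0 < Δ k) ∧
      (∀ k : ℝ, kc < k → Δ k < 0) := by

  intro m cp cg Δ coth csch
  have hT : 0 < 2 * γ / |β| := div_pos (by linarith) (abs_pos.2 hβ.ne)
  have hβ' : β * (2 * γ / |β|) = -(2 * γ) := by
    rw [abs_of_neg hβ]
    field_simp [hβ.ne]
  obtain ⟨kc, hkc, hkcT⟩ := exists_ilwCurvature_eq hT
  refine ⟨kc, hkc, (ilwCurvature_eq hkc).trans hkcT, fun k hk hkT => ?_, fun k hk hlt => ?_,
    fun k hlt => ?_⟩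
  · exact strictMonoOn_ilwCurvature.injOn hk hkc
      ((ilwCurvature_eq hk).symm.trans (hkT.trans hkcT.symm))
  · refine mul_pos (ilw_phaseVelocity_sub_pos hγ hβ hk) ?_
    have hF := mul_lt_mul_of_neg_left (strictMonoOn_ilwCurvature hk hkc hlt) hβ
    rw [hkcT, hβ'] at hF
    exact (div_pos (by linarith) (pow_pos hk 3)).trans_eq (deriv_ilw_groupVelocity γ β hk).symm
  · have hk : 0 < k := hkc.trans hlt
    refine mul_neg_of_pos_of_neg (ilw_phaseVelocity_sub_pos hγ hβ hk) ?_
    have hF := mul_lt_mul_of_neg_left (strictMonoOn_ilwCurvature hkc hk hlt) hβ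
    rw [hkcT, hβ'] at hF
    exact (deriv_ilw_groupVelocity γ β hk).trans_lt
      (div_neg_of_neg_of_pos (by linarith) (pow_pos hk 3))
end

section
/- Fix γ > 0 and β > 0, and let m(k) = √(tanh(k)/k) for k > 0. Then there exists a unique k_c > 0 satisfying k_c³·|k_c·m''(k_c) + 2m'(k_c)| = 2γ/β; moreover, the modulational instability index Δ(k) = (c_p(k) − c_p(2k))·c_g'(k) of the Ostrovsky–Whitham equation satisfies Δ(k) > 0 for 0 < k < k_c and Δ(k) < 0 for k > k_c. -/
open Real Set in
theorem Real.hasDerivAt_tanh_one_sub_sq (x : ℝ) : HasDerivAt tanh (1 - tanh x ^ 2) x := by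
  have hc := (cosh_pos x).ne'
  have h := (hasDerivAt_sinh x).div (hasDerivAt_cosh x) hc
  have hf : tanh = sinh / cosh := by
    ext y; simp [tanh_eq_sinh_div_cosh]
  rw [hf]
  refine h.congr_deriv ?_
  simp only [Pi.div_apply]
  field_simp

theorem Real.tanh_pos_of_pos {x : ℝ} (hx : 0 < x) : 0 < Real.tanh x := by
  rw [Real.tanh_eq_sinh_div_cosh]
  exact div_pos (Real.sinh_pos_iff.2 hx) (Real.cosh_pos x)

theorem Real.one_sub_tanh_sq (x : ℝ) : 1 - Real.tanh x ^ 2 = 1 / Real.cosh x ^ 2 := by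
  have hc := (Real.cosh_pos x).ne'
  have h := Real.cosh_sq x
  rw [Real.tanh_eq_sinh_div_cosh]
  field_simp
  linarith

namespace Whitham

open Real Set

/-- The Whitham symbol `√(tanh k / k)`. -/
noncomputable def symbol (k : ℝ) : ℝ := √(tanh k / k)

/-- A positive multiple of `-(k · symbol k)''`, cleared of its radicals. -/
noncomputable def concavity (k : ℝ) : ℝ :=
  (tanh k - k * (1 - tanh k ^ 2)) ^ 2 + 4 * k ^ 2 * tanh k ^ 2 * (1 - tanh k ^ 2)

/-- The function `-k³ (k · symbol k)''` on the positive half-line. -/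
noncomputable def criterion (k : ℝ) : ℝ := concavity k / (4 * symbol k ^ 3)

theorem symbol_pos {k : ℝ} (hk : 0 < k) : 0 < symbol k :=
  sqrt_pos.2 (div_pos (tanh_pos_of_pos hk) hk)

theorem symbol_sq {k : ℝ} (hk : 0 < k) : symbol k ^ 2 = tanh k / k :=
  sq_sqrt (div_pos (tanh_pos_of_pos hk) hk).le

theorem tanh_eq_mul_symbol_sq {k : ℝ} (hk : 0 < k) : tanh k = k * symbol k ^ 2 := by
  rw [symbol_sq hk]; field_simp

theorem concavity_pos {k : ℝ} (hk : 0 < k) : 0 < concavity k := by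
  have h1 := tanh_pos_of_pos hk
  have h2 : 0 < 1 - tanh k ^ 2 := by
    rw [one_sub_tanh_sq]; exact div_pos one_pos (pow_pos (cosh_pos k) 2)
  unfold concavity
  positivity

theorem criterion_pos {k : ℝ} (hk : 0 < k) : 0 < criterion k :=
  div_pos (concavity_pos hk) (mul_pos four_pos (pow_pos (symbol_pos hk) 3))

theorem hasDerivAt_symbol {k : ℝ} (hk : 0 < k) :
    HasDerivAt symbol ((k * (1 - tanh k ^ 2) - tanh k) / (2 * k ^ 2 * symbol k)) k := by
  have h := ((hasDerivAt_tanh_one_sub_sq k).div (hasDerivAt_id k) hk.ne').sqrt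
    (div_pos (tanh_pos_of_pos hk) hk).ne'
  refine h.congr_deriv ?_
  have := (symbol_pos hk).ne'
  simp only [Pi.div_apply, id]
  change _ / (2 * symbol k) = _
  field_simp

theorem deriv_symbol {k : ℝ} (hk : 0 < k) :
    deriv symbol k = (k * (1 - tanh k ^ 2) - tanh k) / (2 * k ^ 2 * symbol k) :=
  (hasDerivAt_symbol hk).deriv

theorem hasDerivAt_deriv_symbol {k : ℝ} (hk : 0 < k) :
    HasDerivAt (deriv symbol)
      (-(criterion k / k ^ 3 + 2 * deriv symbol k) / k) k := by
  have hT := hasDerivAt_tanh_one_sub_sq k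
  have hn := ((hasDerivAt_id k).mul ((hT.pow 2).const_sub 1)).sub hT
  have hd := ((((hasDerivAt_id k).pow 2).const_mul 2).mul (hasDerivAt_symbol hk))
  have hw := (symbol_pos hk).ne'
  have h := hn.div hd (by simp [hk.ne', hw])
  have he : deriv symbol =ᶠ[nhds k]
      fun k => (k * (1 - tanh k ^ 2) - tanh k) / (2 * k ^ 2 * symbol k) := by
    filter_upwards [Ioi_mem_nhds hk] with y hy using deriv_symbol hy
  refine (HasDerivAt.congr_of_eventuallyEq ?_ he)
  refine h.congr_deriv ?_
  rw [deriv_symbol hk]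
  simp only [criterion, concavity, Pi.mul_apply, Pi.sub_apply, Pi.pow_apply, id]
  have ht := tanh_eq_mul_symbol_sq hk
  generalize symbol k = w at *
  rw [ht]
  field_simp
  ring

theorem mul_deriv_deriv_symbol_add {k : ℝ} (hk : 0 < k) :
    k * deriv (deriv symbol) k + 2 * deriv symbol k = -(criterion k / k ^ 3) := by
  rw [(hasDerivAt_deriv_symbol hk).deriv]
  field_simp
  ring

theorem symbol_two_mul_lt {k : ℝ} (hk : 0 < k) : symbol (2 * k) < symbol k := by
  have hs := sinh_pos_iff.2 hk
  have hc := cosh_pos k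
  apply sqrt_lt_sqrt (div_pos (tanh_pos_of_pos (by positivity)) (by positivity)).le
  rw [tanh_eq_sinh_div_cosh, tanh_eq_sinh_div_cosh, sinh_two_mul, cosh_two_mul, div_div, div_div,
    div_lt_div_iff₀ (by positivity) (by positivity)]
  have : 0 < 2 * k * sinh k ^ 3 := by positivity
  linarith

theorem sinh_lower_bound {x : ℝ} (hx : 4 < x) :
    6 * x ≤ sinh x ∧ 24 * x ^ 2 * (12 * x - 53) < 125 * sinh x := by
  have h := sum_le_exp_of_nonneg (x := x) (by linarith) 9
  have h' : exp (-x) ≤ 1 := exp_le_one_iff.2 (by linarith)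
  rw [sinh_eq]
  simp only [Finset.sum_range_succ, Finset.sum_range_zero, Nat.factorial] at h
  norm_num at h
  obtain ⟨t, rfl⟩ : ∃ t, x = 4 + t := ⟨x - 4, by ring⟩
  have ht : 0 < t := by linarith
  constructor
  · have : 0 < t ^ 2 ∧ 0 < t ^ 3 ∧ 0 < t ^ 4 ∧ 0 < t ^ 5 ∧ 0 < t ^ 6 ∧ 0 < t ^ 7 ∧ 0 < t ^ 8 := by
      refine ⟨?_, ?_, ?_, ?_, ?_, ?_, ?_⟩ <;> positivity
    nlinarith
  · have : 0 < t ^ 2 ∧ 0 < t ^ 3 ∧ 0 < t ^ 4 ∧ 0 < t ^ 5 ∧ 0 < t ^ 6 ∧ 0 < t ^ 7 ∧ 0 < t ^ 8 := by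
      refine ⟨?_, ?_, ?_, ?_, ?_, ?_, ?_⟩ <;> positivity
    nlinarith [mul_nonneg ht.le (sq_nonneg (t - 2)), mul_nonneg ht.le (sq_nonneg (t - 3)),
      sq_nonneg (t - 2), sq_nonneg (t * (t - 2)), sq_nonneg (t - 1)]

theorem hyperbolic_ineq {x : ℝ} (hx : 0 < x) :
    0 < 3 * (sinh x - x) ^ 3
      + 2 * x ^ 2 * (cosh x - 1) * (9 * sinh x - x * (2 * cosh x - 1)) := by
  have hs := self_lt_sinh_iff.2 hx
  have hc : 1 < cosh x := one_lt_cosh.2 hx.ne'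
  have hcs : cosh x - sinh x ≤ 1 := by
    rw [cosh_sub_sinh]; exact exp_le_one_iff.2 (by linarith)
  have hlow := sinh_lower_bound (x := x)
  generalize sinh x = s at *
  generalize cosh x = c at *
  have hB : s * (9 - 2 * x) - x ≤ 9 * s - x * (2 * c - 1) := by nlinarith
  have h3 : 0 < 3 * (s - x) ^ 3 := by have := sub_pos.2 hs; positivity
  have h2 : 0 ≤ 2 * x ^ 2 * (c - 1) := by have := sub_pos.2 hc; positivity
  rcases le_or_gt 0 (9 * s - x * (2 * c - 1)) with h0 | h0
  · positivity
  have hx4 : 4 < x := by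
    by_contra! h
    nlinarith
  obtain ⟨h6, hl⟩ := hlow hx4
  have hneg : s * (9 - 2 * x) - x < 0 := by linarith
  have h4 : s * (s * (9 - 2 * x) - x) ≤ (c - 1) * (9 * s - x * (2 * c - 1)) := by
    nlinarith [mul_nonneg (by linarith : 0 ≤ s - (c - 1)) (by linarith : 0 ≤ -(s * (9 - 2 * x) - x))]
  have h5 : (5 / 6 * s) ^ 3 ≤ (s - x) ^ 3 := pow_le_pow_left₀ (by linarith) (by linarith) 3
  have h7 : 2 * x ^ 2 * (s * (s * (9 - 2 * x) - x)) ≤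
      2 * x ^ 2 * ((c - 1) * (9 * s - x * (2 * c - 1))) := by gcongr
  have hs0 : 0 < s := by linarith
  have h8 : 0 < s ^ 2 * (125 * s - 24 * x ^ 2 * (12 * x - 53)) :=
    mul_pos (by positivity) (by linarith)
  have h9 : 0 ≤ x ^ 2 * s * (s - 6 * x) := mul_nonneg (by positivity) (by linarith)
  nlinarith

/-- The square of `criterion`, up to a constant, in the variable `x = 2k`. -/
noncomputable def criterionSq (x : ℝ) : ℝ :=
  x ^ 3 * ((sinh x - x) ^ 2 + 2 * x ^ 2 * (cosh x - 1)) ^ 2 / (sinh x ^ 3 * (cosh x + 1))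

theorem criterionSq_strictMonoOn : StrictMonoOn criterionSq (Ioi 0) := by
  have key : ∀ x ∈ Ioi (0 : ℝ), ∃ d, 0 < d ∧ HasDerivAt criterionSq d x := by
    intro x hx
    have hx : 0 < x := hx
    have hs := sinh_pos_iff.2 hx
    have hc : 1 < cosh x := one_lt_cosh.2 hx.ne'
    have hS := hasDerivAt_sinh x
    have hC := hasDerivAt_cosh x
    have hI := hasDerivAt_id x
    have hN := ((hS.sub hI).pow 2).add (((hI.pow 2).const_mul 2).mul (hC.sub_const 1))
    have hD := (hS.pow 3).mul (hC.add_const 1)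
    have hne : sinh x ^ 3 * (cosh x + 1) ≠ 0 := by positivity
    have h := ((hI.pow 3).mul (hN.pow 2)).div hD hne
    refine ⟨_, ?_, h⟩
    have hP := hyperbolic_ineq hx
    have hcs := cosh_sq x
    simp only [Pi.mul_apply, Pi.add_apply, Pi.sub_apply, Pi.pow_apply, id]
    refine div_pos ?_ (by positivity)
    generalize sinh x = s at *
    generalize cosh x = c at *
    have hN0 : 0 < (s - x) ^ 2 + 2 * x ^ 2 * (c - 1) := by
      have := sub_pos.2 hc
      positivity
    have hfin : 0 < x ^ 2 * ((s - x) ^ 2 + 2 * x ^ 2 * (c - 1)) * s ^ 2 * (c + 1) *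
      (3 * (s - x) ^ 3 + 2 * x ^ 2 * (c - 1) * (9 * s - x * (2 * c - 1))) := by positivity
    refine hfin.trans_eq ?_
    push_cast
    symm
    linear_combination x ^ 2 * ((s - x) ^ 2 + 2 * x ^ 2 * (c - 1)) * s ^ 2 *
      (x * ((s - x) ^ 2 + 2 * x ^ 2 * (c - 1)) - 4 * x ^ 3 * (c + 1)) * hcs
  refine strictMonoOn_of_deriv_pos (convex_Ioi 0) ?_ ?_
  · intro x hx
    obtain ⟨d, -, h⟩ := key x hx
    exact h.continuousAt.continuousWithinAt
  · intro x hx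
    rw [interior_Ioi] at hx
    obtain ⟨d, hd, h⟩ := key x hx
    rwa [h.deriv]

theorem criterion_sq {k : ℝ} (hk : 0 < k) : criterion k ^ 2 = criterionSq (2 * k) / 128 := by
  have hs := (sinh_pos_iff.2 hk).ne'
  have hc := (cosh_pos k).ne'
  have hw := (symbol_pos hk).ne'
  have h6 : symbol k ^ 6 = (sinh k / cosh k / k) ^ 3 := by
    rw [← tanh_eq_sinh_div_cosh, ← symbol_sq hk]; ring
  have hcs := cosh_sq k
  have e1 : cosh k ^ 2 + sinh k ^ 2 + 1 = 2 * cosh k ^ 2 := by linarith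
  have e2 : cosh k ^ 2 + sinh k ^ 2 - 1 = 2 * sinh k ^ 2 := by linarith
  have hL : criterion k ^ 2 = concavity k ^ 2 / (16 * symbol k ^ 6) := by
    unfold criterion; rw [div_pow]; congr 1; ring
  have hG : concavity k =
      ((sinh k * cosh k - k) ^ 2 + 4 * k ^ 2 * sinh k ^ 2) / cosh k ^ 4 := by
    unfold concavity
    rw [one_sub_tanh_sq, tanh_eq_sinh_div_cosh]
    field_simp
  rw [hL, hG, h6, criterionSq, sinh_two_mul, cosh_two_mul, e1, e2]
  field_simp
  ring

theorem criterion_strictMonoOn : StrictMonoOn criterion (Ioi 0) := by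
  intro a ha b hb hab
  have ha : 0 < a := ha
  have hb : 0 < b := hb
  have h := criterionSq_strictMonoOn (mem_Ioi.2 (by linarith : 0 < 2 * a))
    (mem_Ioi.2 (by linarith : 0 < 2 * b)) (by linarith)
  refine lt_of_pow_lt_pow_left₀ 2 (criterion_pos hb).le ?_
  rw [criterion_sq ha, criterion_sq hb]
  linarith

theorem continuousOn_criterion : ContinuousOn criterion (Ioi 0) := by
  have hT : Continuous tanh :=
    continuous_iff_continuousAt.2 fun x => (hasDerivAt_tanh_one_sub_sq x).continuousAt
  have hw : ContinuousOn symbol (Ioi 0) := fun x hx =>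
    (hasDerivAt_symbol hx).continuousAt.continuousWithinAt
  refine ContinuousOn.div ?_ (by fun_prop) fun x hx => ?_
  · unfold concavity
    fun_prop
  · have := symbol_pos hx
    positivity

theorem criterion_le {k : ℝ} (hk : 0 < k) (hk1 : k ≤ 1) : criterion k ≤ 5 / 4 * k := by
  have hs := sinh_pos_iff.2 hk
  have hks := self_lt_sinh_iff.2 hk
  have hc := one_le_cosh k
  have hT := tanh_pos_of_pos hk
  have hS : 0 ≤ 1 - tanh k ^ 2 := by
    rw [one_sub_tanh_sq]; positivity
  have hkS : k * (1 - tanh k ^ 2) ≤ tanh k := by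
    rw [one_sub_tanh_sq, tanh_eq_sinh_div_cosh, mul_one_div,
      div_le_div_iff₀ (by positivity) (by positivity)]
    nlinarith [mul_pos hs (cosh_pos k), mul_nonneg hs.le (sub_nonneg.2 hc), cosh_pos k]
  have hTk : tanh k ≤ k := by
    have hd : ∀ x, HasDerivAt (fun y => y - tanh y) (1 - (1 - tanh x ^ 2)) x := fun x =>
      (hasDerivAt_id x).sub (hasDerivAt_tanh_one_sub_sq x)
    have hm : Monotone fun y => y - tanh y :=
      monotone_of_deriv_nonneg (fun x => (hd x).differentiableAt) fun x => by
        rw [(hd x).deriv]; nlinarith [sq_nonneg (tanh x)]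
    have := hm hk.le
    simp only [tanh_zero, sub_zero] at this
    linarith
  have hw := symbol_pos hk
  have hw1 : symbol k ≤ 1 := by
    have h2 := symbol_sq hk
    have : tanh k / k ≤ 1 := (div_le_one hk).2 hTk
    nlinarith
  have hG : concavity k ≤ tanh k ^ 2 * (1 + 4 * k ^ 2) := by
    unfold concavity
    have h1 : (tanh k - k * (1 - tanh k ^ 2)) ^ 2 ≤ tanh k ^ 2 := by
      have : 0 ≤ k * (1 - tanh k ^ 2) := by positivity
      exact pow_le_pow_left₀ (by linarith) (by linarith) 2
    have h2 : 4 * k ^ 2 * tanh k ^ 2 * (1 - tanh k ^ 2) ≤ 4 * k ^ 2 * tanh k ^ 2 * 1 := by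
      gcongr
      linarith [sq_nonneg (tanh k)]
    linarith
  unfold criterion
  rw [div_le_iff₀ (by positivity)]
  rw [tanh_eq_mul_symbol_sq hk] at hG
  refine hG.trans ?_
  have hk5 : k * (1 + 4 * k ^ 2) ≤ 5 := by nlinarith [mul_nonneg hk.le hk.le]
  have : k * symbol k ^ 3 * (symbol k * (k * (1 + 4 * k ^ 2))) ≤ k * symbol k ^ 3 * (1 * 5) := by
    gcongr
  linarith

theorem le_criterion {k : ℝ} (hk : 2 ≤ k) : k / 9 ≤ criterion k := by
  have hk0 : 0 < k := by linarith
  have hc : 1 + k ^ 2 / 2 ≤ cosh k := by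
    have h1 := self_lt_sinh_iff.2 (half_pos hk0)
    have h2 := cosh_sq (k / 2)
    have h3 := cosh_two_mul (k / 2)
    rw [mul_div_cancel₀ k two_ne_zero] at h3
    nlinarith
  have hT1 := tanh_lt_one k
  have hT := tanh_pos_of_pos hk0
  have hcp := cosh_pos k
  have hS : 1 - tanh k ^ 2 ≤ 1 / 9 := by
    rw [one_sub_tanh_sq]
    apply one_div_le_one_div_of_le (by norm_num)
    have : 3 ≤ cosh k := by nlinarith
    nlinarith
  have hkS : k * (1 - tanh k ^ 2) ≤ 2 / 9 := by
    rw [one_sub_tanh_sq, mul_one_div, div_le_div_iff₀ (by positivity) (by norm_num)]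
    have : (1 + k ^ 2 / 2) ^ 2 ≤ cosh k ^ 2 := pow_le_pow_left₀ (by positivity) hc 2
    nlinarith [pow_pos hk0 3, mul_nonneg (sub_nonneg.2 hk) (pow_pos hk0 3).le,
      mul_nonneg (sub_nonneg.2 hk) (pow_pos hk0 2).le]
  have hS0 : 0 ≤ 1 - tanh k ^ 2 := by rw [one_sub_tanh_sq]; positivity
  have hG : (2 / 3) ^ 2 ≤ concavity k := by
    unfold concavity
    have h1 : (2 / 3 : ℝ) ^ 2 ≤ (tanh k - k * (1 - tanh k ^ 2)) ^ 2 :=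
      pow_le_pow_left₀ (by norm_num) (by nlinarith) 2
    have : 0 ≤ 4 * k ^ 2 * tanh k ^ 2 * (1 - tanh k ^ 2) := by positivity
    linarith
  have hw := symbol_pos hk0
  have hkw : k * symbol k ^ 2 ≤ 1 := by rw [← tanh_eq_mul_symbol_sq hk0]; exact hT1.le
  have hw1 : symbol k ≤ 1 := by nlinarith
  unfold criterion
  rw [le_div_iff₀ (by positivity)]
  have : k * symbol k ^ 2 * symbol k ≤ 1 * 1 := by gcongr
  linarith

theorem exists_criterion_eq {a : ℝ} (ha : 0 < a) : ∃ k, 0 < k ∧ criterion k = a := by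
  have h0 : 0 < min 1 (a / 2) := by positivity
  have hl : criterion (min 1 (a / 2)) ≤ a := by
    have := criterion_le h0 (min_le_left _ _)
    have := min_le_right 1 (a / 2)
    linarith
  have hr : a ≤ criterion (max 2 (9 * a)) := by
    have := le_criterion (le_max_left 2 (9 * a))
    have := le_max_right 2 (9 * a)
    linarith
  obtain ⟨k, hk, hka⟩ := isPreconnected_Ioi.intermediate_value (mem_Ioi.2 h0)
    (mem_Ioi.2 (lt_of_lt_of_le two_pos (le_max_left 2 (9 * a)))) continuousOn_criterion ⟨hl, hr⟩
  exact ⟨k, hk, hka⟩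

theorem deriv_groupVelocity (β γ : ℝ) {k : ℝ} (hk : 0 < k) :
    deriv (fun k => β * (symbol k + k * deriv symbol k) - γ / k ^ 2) k
      = (2 * γ - β * criterion k) / k ^ 3 := by
  have h1 := hasDerivAt_symbol hk
  rw [← deriv_symbol hk] at h1
  have h := ((h1.add ((hasDerivAt_id k).mul (hasDerivAt_deriv_symbol hk))).const_mul β).sub
    ((hasDerivAt_const k γ).div ((hasDerivAt_id k).pow 2) (by simp [hk.ne']))
  refine (h.congr_deriv ?_).deriv
  simp only [Pi.pow_apply, id]
  field_simp
  ring

end Whitham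


/-- For the Ostrovsky–Whitham equation (symbol `m(k) = √(tanh(k)/k)`) with
`γ > 0`, `β > 0`: there is a unique `k_c > 0` with
`k_c³·|k_c·m''(k_c) + 2m'(k_c)| = 2γ/β`, and the modulational instability index
`Δ(k) = (c_p(k) − c_p(2k))·c_g'(k)` satisfies `Δ(k) > 0` for `0 < k < k_c` and
`Δ(k) < 0` for `k > k_c`. -/
theorem stmt_10 (γ β : ℝ) (hγ : 0 < γ) (hβ : 0 < β) :
    let m : ℝ → ℝ := fun k => Real.sqrt (Real.tanh k / k)
    let cp : ℝ → ℝ := fun k => β * m k + γ / k ^ 2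
    let cg : ℝ → ℝ := fun k => β * (m k + k * deriv m k) - γ / k ^ 2
    let Δ : ℝ → ℝ := fun k => (cp k - cp (2 * k)) * deriv cg k
    ∃ kc : ℝ, 0 < kc ∧
      kc ^ 3 * |kc * deriv (deriv m) kc + 2 * deriv m kc| = 2 * γ / β ∧
      (∀ k : ℝ, 0 < k →
        k ^ 3 * |k * deriv (deriv m) k + 2 * deriv m k| = 2 * γ / β → k = kc) ∧
      (∀ k : ℝ, 0 < k → k < kc → 0 < Δ k) ∧
      (∀ k : ℝ, kc < k → Δ k < 0) := by
  intro m cp cg Δ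
  have hm : m = Whitham.symbol := rfl
  have hcrit : ∀ k : ℝ, 0 < k →
      k ^ 3 * |k * deriv (deriv m) k + 2 * deriv m k| = Whitham.criterion k := by
    intro k hk
    have := Whitham.criterion_pos hk
    rw [hm, Whitham.mul_deriv_deriv_symbol_add hk, abs_neg, abs_of_pos (by positivity)]
    field_simp
  have hcp : ∀ k : ℝ, 0 < k → 0 < cp k - cp (2 * k) := by
    intro k hk
    have h1 : β * m (2 * k) < β * m k :=
      mul_lt_mul_of_pos_left (Whitham.symbol_two_mul_lt hk) hβ
    have h2 : γ / (2 * k) ^ 2 < γ / k ^ 2 :=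
      div_lt_div_of_pos_left hγ (by positivity) (by nlinarith [pow_pos hk 2])
    simp only [cp]
    linarith
  obtain ⟨kc, hkc, hkc'⟩ := Whitham.exists_criterion_eq (a := 2 * γ / β) (by positivity)
  have hβkc : β * Whitham.criterion kc = 2 * γ := by rw [hkc']; field_simp
  refine ⟨kc, hkc, by rw [hcrit kc hkc, hkc'], fun k hk h => ?_, fun k hk h => ?_, fun k h => ?_⟩
  · rw [hcrit k hk, ← hkc'] at h
    exact Whitham.criterion_strictMonoOn.injOn hk hkc h
  · refine mul_pos (hcp k hk) ?_
    have := mul_lt_mul_of_pos_left (Whitham.criterion_strictMonoOn hk hkc h) hβ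
    rw [show deriv cg k = _ from Whitham.deriv_groupVelocity β γ hk]
    exact div_pos (by linarith) (by positivity)
  · have hk : 0 < k := hkc.trans h
    refine mul_neg_of_pos_of_neg (hcp k hk) ?_
    have := mul_lt_mul_of_pos_left (Whitham.criterion_strictMonoOn hkc hk h) hβ
    rw [show deriv cg k = _ from Whitham.deriv_groupVelocity β γ hk]
    exact div_neg_of_neg_of_pos (by linarith) (by positivity)
end
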